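/- arXiv:2605.04792 — 2 statements merged into one kernel-verified Lean document; each statement's English description precedes it below -/
import Mathlib

section
/- Fix integers k₁, k₂ ≥ 0 with k = k₁ + k₂ ≥ 1. Then, as X → ∞, #{a ∈ 𝒜 : |𝒟(a)| ≤ X, ω₁(a) = k₁, ω₃(a) = k₂} ≪ (X^{1/3}/((k−1)!·log X))·(log log X)^{k−1}. -/
/- STATEMENT 17: Fix k₁, k₂ ≥ 0 with k = k₁ + k₂ ≥ 1. Then, as X → ∞,
#{a ∈ 𝒜 : |𝒟(a)| ≤ X, ω₁(a) = k₁, ω₃(a) = k₂}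
  ≪ (X^{1/3}/((k−1)!·log X))·(log log X)^{k−1}. -/

open scoped Classical
open Filter
noncomputable section

/-- `a ∈ 𝒜`: integers `a ≥ 2` such that every exponent in the prime factorization of `a`
equals 1 or 3; these parametrize the pure quartic fields ℚ(⁴√a). -/
def memA (a : ℕ) : Prop :=
  2 ≤ a ∧ ∀ p : ℕ, p.Prime → p ∣ a → a.factorization p = 1 ∨ a.factorization p = 3

/-- The discriminant of the pure quartic field ℚ(⁴√a). -/
def discA (a : ℕ) : ℤ :=
  if a % 8 = 1 then -4 * (a : ℤ) ^ 3
  else if a % 8 = 5 then -16 * (a : ℤ) ^ 3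
  else -256 * (a : ℤ) ^ 3

/-- `ω_i(a)`: the number of distinct prime divisors `p` of `a` with `p ≡ i (mod 4)`. -/
def omegaMod4 (i : ℕ) (a : ℕ) : ℕ :=
  (a.primeFactors.filter fun p => p % 4 = i).card

/-- The integers in `[1, N]` with exactly `k` distinct prime factors and with all exponents in the
prime factorization at most `3`. -/
def fourthPowerFree (k N : ℕ) : Finset ℕ :=
  (Finset.Icc 1 N).filter fun m => (∀ p, m.factorization p ≤ 3) ∧ m.primeFactors.card = k

theorem mem_fourthPowerFree {k N m : ℕ} :
    m ∈ fourthPowerFree k N ↔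
      (1 ≤ m ∧ m ≤ N) ∧ (∀ p, m.factorization p ≤ 3) ∧ m.primeFactors.card = k := by
  simp [fourthPowerFree]

theorem primeFactors_ordCompl (m p : ℕ) :
    (m / p ^ m.factorization p).primeFactors = m.primeFactors.erase p := by
  rw [← Nat.support_factorization, Nat.factorization_ordCompl, Finsupp.support_erase,
    Nat.support_factorization]

theorem ordCompl_mem_fourthPowerFree {k N m p : ℕ} (hm : m ∈ fourthPowerFree (k + 1) N)
    (hp : p ∈ m.primeFactors) : m / p ^ m.factorization p ∈ fourthPowerFree k N := by
  rw [mem_fourthPowerFree] at hm ⊢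
  obtain ⟨⟨h1, h2⟩, h3, h4⟩ := hm
  refine ⟨⟨Nat.ordCompl_pos p (by omega), (Nat.ordCompl_le m p).trans h2⟩, fun q => ?_, ?_⟩
  · rw [Nat.factorization_ordCompl, Finsupp.erase_apply]
    split_ifs
    · simp
    · exact h3 q
  · rw [primeFactors_ordCompl, Finset.card_erase_of_mem hp, h4, Nat.add_sub_cancel]

/-- Splitting off the exact power of one prime divisor from an element of `fourthPowerFree`. -/
theorem sum_fourthPowerFree_succ_le (k N : ℕ) (f : ℕ → ℕ → ℝ) (hf : ∀ m p, 0 ≤ f m p) :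
    ∑ m ∈ fourthPowerFree (k + 1) N, ∑ p ∈ m.primeFactors, f m p ≤
      ∑ n ∈ fourthPowerFree k N, ∑ v ∈ Finset.Icc 1 3, ∑ p ∈ Nat.primesLE (N / n),
        f (p ^ v * n) p := by
  have hR : ∀ n, ∑ v ∈ Finset.Icc 1 3, ∑ p ∈ Nat.primesLE (N / n), f (p ^ v * n) p =
      ∑ x ∈ Finset.Icc 1 3 ×ˢ Nat.primesLE (N / n), f (x.2 ^ x.1 * n) x.2 := fun n => by
    rw [Finset.sum_product]
  simp_rw [hR]
  rw [Finset.sum_sigma', Finset.sum_sigma']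
  let i : (Σ _ : ℕ, ℕ) → (Σ _ : ℕ, ℕ × ℕ) := fun x =>
    ⟨x.1 / x.2 ^ x.1.factorization x.2, (x.1.factorization x.2, x.2)⟩
  have hi : ∀ x, (i x).2.2 ^ (i x).2.1 * (i x).1 = x.1 := fun x =>
    Nat.ordProj_mul_ordCompl_eq_self x.1 x.2
  have hinj : Function.Injective i := by
    rintro ⟨m, p⟩ ⟨m', p'⟩ h
    have h1 := hi ⟨m, p⟩
    have h2 := hi ⟨m', p'⟩
    have h3 : p = p' := congrArg (fun y : (Σ _ : ℕ, ℕ × ℕ) => y.2.2) h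
    rw [h, h2] at h1
    simp only at h1
    rw [h1, h3]
  have hsum : ∑ x ∈ (fourthPowerFree (k + 1) N).sigma fun m => m.primeFactors, f x.1 x.2 =
      ∑ y ∈ ((fourthPowerFree (k + 1) N).sigma fun m => m.primeFactors).image i,
        f (y.2.2 ^ y.2.1 * y.1) y.2.2 := by
    rw [Finset.sum_image hinj.injOn]
    refine Finset.sum_congr rfl fun x _ => ?_
    rw [hi]
  rw [hsum]
  refine Finset.sum_le_sum_of_subset_of_nonneg ?_ fun _ _ _ => hf _ _
  intro y hy
  obtain ⟨⟨m, p⟩, hx, rfl⟩ := Finset.mem_image.1 hy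
  rw [Finset.mem_sigma] at hx
  obtain ⟨hm, hp⟩ := hx
  simp only at hm hp
  have hm' := mem_fourthPowerFree.1 hm
  have hn := ordCompl_mem_fourthPowerFree hm hp
  have hn' := mem_fourthPowerFree.1 hn
  have hpp := Nat.prime_of_mem_primeFactors hp
  have hv : 1 ≤ m.factorization p :=
    hpp.factorization_pos_of_dvd (by omega) (Nat.dvd_of_mem_primeFactors hp)
  simp only [i, Finset.mem_sigma, Finset.mem_product, Finset.mem_Icc, Nat.mem_primesLE]
  refine ⟨hn, ⟨hv, hm'.2.1 p⟩, ?_, hpp⟩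
  rw [Nat.le_div_iff_mul_le hn'.1.1]
  calc p * (m / p ^ m.factorization p)
      ≤ p ^ m.factorization p * (m / p ^ m.factorization p) := by
        gcongr
        exact Nat.le_self_pow (by omega) p
    _ = m := Nat.ordProj_mul_ordCompl_eq_self m p
    _ ≤ N := hm'.1.2

theorem sum_inv_fourthPowerFree_le (k N : ℕ) :
    ∑ m ∈ fourthPowerFree k N, (1 : ℝ) / m ≤ (3 * ∑ p ∈ Nat.primesLE N, (1 : ℝ) / p) ^ k := by
  induction k with
  | zero =>
    have hsub : fourthPowerFree 0 N ⊆ {1} := fun m hm => by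
      rw [mem_fourthPowerFree, Finset.card_eq_zero, Nat.primeFactors_eq_empty] at hm
      simp only [Finset.mem_singleton]
      omega
    calc ∑ m ∈ fourthPowerFree 0 N, (1 : ℝ) / m ≤ ∑ m ∈ ({1} : Finset ℕ), (1 : ℝ) / m :=
          Finset.sum_le_sum_of_subset_of_nonneg hsub fun _ _ _ => by positivity
      _ = _ := by simp
  | succ k ih =>
    have hP : 0 ≤ ∑ p ∈ Nat.primesLE N, (1 : ℝ) / p := Finset.sum_nonneg fun _ _ => by positivity
    calc ∑ m ∈ fourthPowerFree (k + 1) N, (1 : ℝ) / m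
        ≤ ∑ m ∈ fourthPowerFree (k + 1) N, ∑ p ∈ m.primeFactors, (1 : ℝ) / m := by
          refine Finset.sum_le_sum fun m hm => ?_
          rw [Finset.sum_const, (mem_fourthPowerFree.1 hm).2.2, nsmul_eq_mul]
          refine le_mul_of_one_le_left (by positivity) ?_
          push_cast
          linarith [(k.cast_nonneg : (0 : ℝ) ≤ k)]
      _ ≤ ∑ n ∈ fourthPowerFree k N, ∑ v ∈ Finset.Icc 1 3, ∑ p ∈ Nat.primesLE (N / n),
            (1 : ℝ) / (p ^ v * n : ℕ) :=
          sum_fourthPowerFree_succ_le k N (fun m _ => (1 : ℝ) / m) fun _ _ => by positivity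
      _ ≤ ∑ n ∈ fourthPowerFree k N, ∑ v ∈ Finset.Icc 1 3, ∑ p ∈ Nat.primesLE N,
            (1 : ℝ) / p * (1 / n) := by
          refine Finset.sum_le_sum fun n hn => Finset.sum_le_sum fun v hv => ?_
          have hn0 : 0 < n := (mem_fourthPowerFree.1 hn).1.1
          rw [Finset.mem_Icc] at hv
          calc ∑ p ∈ Nat.primesLE (N / n), (1 : ℝ) / (p ^ v * n : ℕ)
              ≤ ∑ p ∈ Nat.primesLE (N / n), (1 : ℝ) / p * (1 / n) := by
                refine Finset.sum_le_sum fun p hp => ?_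
                have hp0 : 0 < p := (Nat.mem_primesLE.1 hp).2.pos
                rw [one_div_mul_one_div, ← Nat.cast_mul]
                refine one_div_le_one_div_of_le (by positivity) (Nat.cast_le.2 ?_)
                gcongr
                exact Nat.le_self_pow (by omega) p
            _ ≤ ∑ p ∈ Nat.primesLE N, (1 : ℝ) / p * (1 / n) := by
                refine Finset.sum_le_sum_of_subset_of_nonneg (fun p hp => ?_)
                  fun _ _ _ => by positivity
                rw [Nat.mem_primesLE] at hp ⊢
                exact ⟨hp.1.trans (Nat.div_le_self N n), hp.2⟩
      _ = (3 * ∑ p ∈ Nat.primesLE N, (1 : ℝ) / p) * ∑ n ∈ fourthPowerFree k N, (1 : ℝ) / n := by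
          simp only [← Finset.sum_mul, Finset.sum_const, Nat.card_Icc, nsmul_eq_mul,
            ← Finset.mul_sum]
          norm_num
      _ ≤ (3 * ∑ p ∈ Nat.primesLE N, (1 : ℝ) / p) ^ (k + 1) := by
          rw [pow_succ']
          gcongr

theorem sum_log_fourthPowerFree_le (k N : ℕ) :
    ∑ m ∈ fourthPowerFree (k + 1) N, Real.log m ≤
      9 * Real.log 4 * N * (3 * ∑ p ∈ Nat.primesLE N, (1 : ℝ) / p) ^ k := by
  have hlog4 : 0 ≤ Real.log 4 := Real.log_nonneg (by norm_num)
  calc ∑ m ∈ fourthPowerFree (k + 1) N, Real.log m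
      ≤ ∑ m ∈ fourthPowerFree (k + 1) N, ∑ p ∈ m.primeFactors, 3 * Real.log p := by
        refine Finset.sum_le_sum fun m hm => ?_
        rw [Real.log_nat_eq_sum_factorization, Finsupp.sum, Nat.support_factorization]
        refine Finset.sum_le_sum fun p _ => ?_
        have : (m.factorization p : ℝ) ≤ 3 := by exact_mod_cast (mem_fourthPowerFree.1 hm).2.1 p
        exact mul_le_mul_of_nonneg_right this (Real.log_natCast_nonneg p)
    _ ≤ ∑ n ∈ fourthPowerFree k N, ∑ v ∈ Finset.Icc 1 3, ∑ p ∈ Nat.primesLE (N / n),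
          3 * Real.log p :=
        sum_fourthPowerFree_succ_le k N (fun _ p => 3 * Real.log p) fun _ p =>
          mul_nonneg (by norm_num) (Real.log_natCast_nonneg p)
    _ ≤ ∑ n ∈ fourthPowerFree k N, 9 * Real.log 4 * N * (1 / n) := by
        refine Finset.sum_le_sum fun n _ => ?_
        rw [Finset.sum_const, ← Finset.mul_sum, ← Chebyshev.theta_eq_sum_primesLE_log,
          Nat.card_Icc, nsmul_eq_mul]
        have h1 := Chebyshev.theta_le_log4_mul_x (x := ((N / n : ℕ) : ℝ)) (by positivity)
        have h2 : ((N / n : ℕ) : ℝ) ≤ N / n := Nat.cast_div_le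
        have h3 := mul_le_mul_of_nonneg_left h2 hlog4
        norm_num
        rw [div_eq_mul_inv] at h3
        linarith
    _ ≤ _ := by
        rw [← Finset.mul_sum]
        exact mul_le_mul_of_nonneg_left (sum_inv_fourthPowerFree_le k N) (by positivity)

theorem sum_inv_primesLE_two_pow_le (J : ℕ) :
    ∑ p ∈ Nat.primesLE (2 ^ J), (1 : ℝ) / p ≤ 8 * (harmonic J : ℝ) := by
  induction J with
  | zero => simp
  | succ J ih =>
    have hlog2 : 0 < Real.log 2 := Real.log_pos (by norm_num)
    have hlog4 : Real.log 4 = 2 * Real.log 2 := by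
      rw [show (4 : ℝ) = 2 ^ 2 by norm_num, Real.log_pow]
      norm_num
    have hsub : Nat.primesLE (2 ^ J) ⊆ Nat.primesLE (2 ^ (J + 1)) := fun p hp => by
      rw [Nat.mem_primesLE] at hp ⊢
      exact ⟨hp.1.trans (Nat.pow_le_pow_right (by norm_num) (by omega)), hp.2⟩
    have hc : (0 : ℝ) < 2 ^ J * ((J + 1) / 2 * Real.log 2) := by positivity
    have hnew : ∑ p ∈ Nat.primesLE (2 ^ (J + 1)) \ Nat.primesLE (2 ^ J), (1 : ℝ) / p ≤
        8 * (1 / (J + 1)) := by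
      calc ∑ p ∈ Nat.primesLE (2 ^ (J + 1)) \ Nat.primesLE (2 ^ J), (1 : ℝ) / p
          ≤ ∑ p ∈ Nat.primesLE (2 ^ (J + 1)) \ Nat.primesLE (2 ^ J),
              Real.log p / (2 ^ J * ((J + 1) / 2 * Real.log 2)) := by
            refine Finset.sum_le_sum fun p hp => ?_
            rw [Finset.mem_sdiff, Nat.mem_primesLE, Nat.mem_primesLE] at hp
            obtain ⟨⟨_, hpp⟩, hp2⟩ := hp
            have hpJ : 2 ^ J ≤ p := by
              by_contra! h
              exact hp2 ⟨h.le, hpp⟩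
            have hpJ' : (2 : ℝ) ^ J ≤ p := by exact_mod_cast hpJ
            have hp0 : (0 : ℝ) < p := by exact_mod_cast hpp.pos
            have h1 : J * Real.log 2 ≤ Real.log p := by
              rw [← Real.log_pow]
              exact Real.log_le_log (by positivity) hpJ'
            have h2 : Real.log 2 ≤ Real.log p :=
              Real.log_le_log (by norm_num) (by exact_mod_cast hpp.two_le)
            rw [div_le_div_iff₀ hp0 hc, one_mul, mul_comm (Real.log p)]
            exact mul_le_mul hpJ' (by linarith) (by positivity) hp0.le
        _ ≤ ∑ p ∈ Nat.primesLE (2 ^ (J + 1)),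
              Real.log p / (2 ^ J * ((J + 1) / 2 * Real.log 2)) :=
            Finset.sum_le_sum_of_subset_of_nonneg Finset.sdiff_subset fun p _ _ =>
              div_nonneg (Real.log_natCast_nonneg p) hc.le
        _ ≤ Real.log 4 * (2 ^ (J + 1) : ℕ) / (2 ^ J * ((J + 1) / 2 * Real.log 2)) := by
            rw [← Finset.sum_div, ← Chebyshev.theta_eq_sum_primesLE_log]
            gcongr
            exact Chebyshev.theta_le_log4_mul_x (by positivity)
        _ = 8 * (1 / (J + 1)) := by
            rw [hlog4]
            push_cast
            field_simp
            ring
    rw [← Finset.sum_sdiff hsub, harmonic_succ]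
    push_cast
    rw [one_div] at hnew
    linarith

theorem sum_inv_primesLE_le (N : ℕ) :
    ∑ p ∈ Nat.primesLE N, (1 : ℝ) / p ≤ 8 * (1 + Real.log (2 * Real.log N + 1)) := by
  have hJ : ((Nat.log 2 N + 1 : ℕ) : ℝ) ≤ 2 * Real.log N + 1 := by
    rcases Nat.eq_zero_or_pos N with rfl | hN
    · simp
    have h1 : Nat.log 2 N * Real.log 2 ≤ Real.log N := by
      rw [← Real.log_pow]
      exact Real.log_le_log (by positivity) (by exact_mod_cast Nat.pow_log_le_self 2 hN.ne')
    have h2 := Real.log_two_gt_d9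
    push_cast
    nlinarith [(Nat.log 2 N).cast_nonneg (α := ℝ)]
  calc ∑ p ∈ Nat.primesLE N, (1 : ℝ) / p
      ≤ ∑ p ∈ Nat.primesLE (2 ^ (Nat.log 2 N + 1)), (1 : ℝ) / p := by
        refine Finset.sum_le_sum_of_subset_of_nonneg (fun p hp => ?_) fun _ _ _ => by positivity
        rw [Nat.mem_primesLE] at hp ⊢
        exact ⟨hp.1.trans (Nat.lt_pow_succ_log_self (by norm_num) N).le, hp.2⟩
    _ ≤ 8 * (harmonic (Nat.log 2 N + 1) : ℝ) := sum_inv_primesLE_two_pow_le _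
    _ ≤ 8 * (1 + Real.log (Nat.log 2 N + 1 : ℕ)) := by
        gcongr
        exact harmonic_le_one_add_log _
    _ ≤ _ := by gcongr

/-- Hardy–Ramanujan type upper bound, with an unspecified dependence on `k`. -/
theorem card_fourthPowerFree_le {X : ℝ} (k : ℕ) (hX : 1 ≤ X) (hL : 3 ≤ Real.log X)
    (hLX : Real.log X ≤ X ^ ((1 : ℝ) / 6)) :
    ((fourthPowerFree (k + 1) ⌊X ^ ((1 : ℝ) / 3)⌋₊).card : ℝ) ≤
      (1 + 54 * Real.log 4 * 72 ^ k) *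
        (X ^ ((1 : ℝ) / 3) / Real.log X * Real.log (Real.log X) ^ k) := by
  set L := Real.log X with hLdef
  set N := ⌊X ^ ((1 : ℝ) / 3)⌋₊ with hN
  set S := fourthPowerFree (k + 1) N with hS
  have hX0 : 0 < X := by linarith
  have hL0 : 0 < L := by linarith
  have hlog4 : 0 ≤ Real.log 4 := Real.log_nonneg (by norm_num)
  have hLL : 1 ≤ Real.log L := by
    rw [Real.le_log_iff_exp_le hL0]
    exact Real.exp_one_lt_d9.le.trans (by linarith)
  have hY : X ^ ((1 : ℝ) / 3) = X ^ ((1 : ℝ) / 6) * X ^ ((1 : ℝ) / 6) := by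
    rw [← Real.rpow_add hX0]
    norm_num
  have hNle : (N : ℝ) ≤ X ^ ((1 : ℝ) / 3) := Nat.floor_le (by positivity)
  have hN1 : 1 ≤ N := Nat.le_floor (by simpa using Real.one_le_rpow hX (by norm_num))
  have hNX : (N : ℝ) ≤ X := hNle.trans (by
    simpa using Real.rpow_le_rpow_of_exponent_le hX (show (1 : ℝ) / 3 ≤ 1 by norm_num))
  have hlogN : Real.log N ≤ L := Real.log_le_log (by exact_mod_cast hN1) hNX
  have hP : 3 * ∑ p ∈ Nat.primesLE N, (1 : ℝ) / p ≤ 72 * Real.log L := by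
    have h1 := sum_inv_primesLE_le N
    have h2 : Real.log (2 * Real.log N + 1) ≤ Real.log (L ^ 2) :=
      Real.log_le_log (by linarith [Real.log_natCast_nonneg N]) (by nlinarith)
    rw [Real.log_pow] at h2
    push_cast at h2
    linarith
  have hP0 : 0 ≤ 3 * ∑ p ∈ Nat.primesLE N, (1 : ℝ) / p :=
    mul_nonneg (by norm_num) (Finset.sum_nonneg fun _ _ => by positivity)
  have hsmall : ((S.filter fun m : ℕ => (m : ℝ) ≤ X ^ ((1 : ℝ) / 6)).card : ℝ) ≤
      X ^ ((1 : ℝ) / 3) / L * Real.log L ^ k := by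
    have hsub : (S.filter fun m : ℕ => (m : ℝ) ≤ X ^ ((1 : ℝ) / 6)) ⊆
        Finset.Icc 1 ⌊X ^ ((1 : ℝ) / 6)⌋₊ := fun m hm => by
      rw [Finset.mem_filter, hS, mem_fourthPowerFree] at hm
      exact Finset.mem_Icc.2 ⟨hm.1.1.1, Nat.le_floor hm.2⟩
    have h1 := Finset.card_le_card hsub
    rw [Nat.card_Icc, Nat.add_sub_cancel] at h1
    calc ((S.filter fun m : ℕ => (m : ℝ) ≤ X ^ ((1 : ℝ) / 6)).card : ℝ)
        ≤ (⌊X ^ ((1 : ℝ) / 6)⌋₊ : ℝ) := by exact_mod_cast h1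
      _ ≤ X ^ ((1 : ℝ) / 6) := Nat.floor_le (by positivity)
      _ ≤ X ^ ((1 : ℝ) / 3) / L := by
          rw [le_div_iff₀ hL0, hY]
          gcongr
      _ ≤ _ := le_mul_of_one_le_right (by positivity) (one_le_pow₀ hLL)
  have hlarge : ((S.filter fun m : ℕ => ¬ (m : ℝ) ≤ X ^ ((1 : ℝ) / 6)).card : ℝ) * (L / 6) ≤
      9 * Real.log 4 * X ^ ((1 : ℝ) / 3) * (72 * Real.log L) ^ k := by
    calc ((S.filter fun m : ℕ => ¬ (m : ℝ) ≤ X ^ ((1 : ℝ) / 6)).card : ℝ) * (L / 6)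
        = ∑ m ∈ S.filter fun m : ℕ => ¬ (m : ℝ) ≤ X ^ ((1 : ℝ) / 6), L / 6 := by
          rw [Finset.sum_const, nsmul_eq_mul]
      _ ≤ ∑ m ∈ S.filter fun m : ℕ => ¬ (m : ℝ) ≤ X ^ ((1 : ℝ) / 6), Real.log m := by
          refine Finset.sum_le_sum fun m hm => ?_
          have h1 := Real.log_le_log (by positivity) (not_le.1 (Finset.mem_filter.1 hm).2).le
          rw [Real.log_rpow hX0] at h1
          linarith
      _ ≤ ∑ m ∈ S, Real.log m :=
          Finset.sum_le_sum_of_subset_of_nonneg (Finset.filter_subset _ _) fun m _ _ =>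
            Real.log_natCast_nonneg m
      _ ≤ 9 * Real.log 4 * N * (3 * ∑ p ∈ Nat.primesLE N, (1 : ℝ) / p) ^ k :=
          sum_log_fourthPowerFree_le k N
      _ ≤ _ := by gcongr
  rw [← le_div_iff₀ (by positivity)] at hlarge
  have hcard := Finset.card_filter_add_card_filter_not (s := S)
    (fun m : ℕ => (m : ℝ) ≤ X ^ ((1 : ℝ) / 6))
  calc (S.card : ℝ) = (S.filter fun m : ℕ => (m : ℝ) ≤ X ^ ((1 : ℝ) / 6)).card +
        (S.filter fun m : ℕ => ¬ (m : ℝ) ≤ X ^ ((1 : ℝ) / 6)).card := by exact_mod_cast hcard.symm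
    _ ≤ _ := add_le_add hsmall hlarge
    _ = _ := by
      rw [mul_pow]
      field_simp
      ring

theorem pow_three_le_abs_discA (a : ℕ) : (a : ℝ) ^ 3 ≤ |(discA a : ℝ)| := by
  have ha : (0 : ℝ) ≤ (a : ℝ) ^ 3 := by positivity
  unfold discA
  split_ifs <;> push_cast <;> rw [abs_mul, abs_of_nonneg ha] <;> norm_num <;> linarith

theorem ordCompl_two_mem_fourthPowerFree {a k₁ k₂ N : ℕ} (ha : memA a) (haN : a ≤ N)
    (h₁ : omegaMod4 1 a = k₁) (h₃ : omegaMod4 3 a = k₂) :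
    a / 2 ^ a.factorization 2 ∈ fourthPowerFree (k₁ + k₂) N := by
  obtain ⟨ha2, hexp⟩ := ha
  have hle : ∀ p, a.factorization p ≤ 3 := fun p => by
    by_cases hp : p.Prime ∧ p ∣ a
    · rcases hexp p hp.1 hp.2 with h | h <;> omega
    · rcases not_and_or.1 hp with h | h
      · simp [h]
      · simp [Nat.factorization_eq_zero_of_not_dvd h]
  rw [mem_fourthPowerFree]
  refine ⟨⟨Nat.ordCompl_pos 2 (by omega), (Nat.ordCompl_le a 2).trans haN⟩, fun q => ?_, ?_⟩
  · rw [Nat.factorization_ordCompl, Finsupp.erase_apply]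
    split_ifs
    · simp
    · exact hle q
  · have hunion : a.primeFactors.erase 2 =
        (a.primeFactors.filter fun p => p % 4 = 1) ∪
          (a.primeFactors.filter fun p => p % 4 = 3) := by
      ext p
      simp only [Finset.mem_erase, Finset.mem_union, Finset.mem_filter]
      constructor
      · rintro ⟨h2, hp⟩
        have := (Nat.prime_of_mem_primeFactors hp).eq_two_or_odd
        have : p % 4 = 1 ∨ p % 4 = 3 := by omega
        tauto
      · rintro (⟨hp, h⟩ | ⟨hp, h⟩) <;> exact ⟨by omega, hp⟩
    rw [primeFactors_ordCompl, hunion, Finset.card_union_of_disjoint, ← h₁, ← h₃]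
    · rfl
    · rw [Finset.disjoint_filter]
      omega

theorem card_memA_le (k₁ k₂ : ℕ) {X : ℝ} (hX : 0 ≤ X) :
    Nat.card {a : ℕ // memA a ∧ (|discA a| : ℝ) ≤ X ∧
        omegaMod4 1 a = k₁ ∧ omegaMod4 3 a = k₂} ≤
      4 * (fourthPowerFree (k₁ + k₂) ⌊X ^ ((1 : ℝ) / 3)⌋₊).card := by
  set T := Finset.range 4 ×ˢ fourthPowerFree (k₁ + k₂) ⌊X ^ ((1 : ℝ) / 3)⌋₊ with hT
  have hmem : ∀ a : {a : ℕ // memA a ∧ (|discA a| : ℝ) ≤ X ∧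
      omegaMod4 1 a = k₁ ∧ omegaMod4 3 a = k₂},
      (a.1.factorization 2, a.1 / 2 ^ a.1.factorization 2) ∈ T := by
    rintro ⟨a, ha, hd, h₁, h₃⟩
    have haX : (a : ℝ) ≤ X ^ ((1 : ℝ) / 3) := by
      rw [one_div, Real.le_rpow_inv_iff_of_pos (by positivity) hX (by norm_num)]
      exact_mod_cast (pow_three_le_abs_discA a).trans hd
    refine Finset.mem_product.2 ⟨?_, ordCompl_two_mem_fourthPowerFree ha (Nat.le_floor haX) h₁ h₃⟩
    simp only [Finset.mem_range]
    by_cases h : 2 ∣ a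
    · rcases ha.2 2 Nat.prime_two h with h | h <;> omega
    · simp [Nat.factorization_eq_zero_of_not_dvd h]
  have hinj : Function.Injective fun a : {a : ℕ // memA a ∧ (|discA a| : ℝ) ≤ X ∧
      omegaMod4 1 a = k₁ ∧ omegaMod4 3 a = k₂} => (⟨_, hmem a⟩ : T) := by
    intro a b h
    simp only [Subtype.mk.injEq, Prod.mk.injEq] at h
    apply Subtype.ext
    rw [← Nat.ordProj_mul_ordCompl_eq_self a.1 2, ← Nat.ordProj_mul_ordCompl_eq_self b.1 2, h.2,
      h.1]
  have h := Nat.card_le_card_of_injective _ hinj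
  rwa [Nat.card_eq_fintype_card (α := T), Fintype.card_coe, hT, Finset.card_product,
    Finset.card_range] at h

theorem stmt_17 (k₁ k₂ : ℕ) (hk : 1 ≤ k₁ + k₂) :
    (fun X : ℝ =>
        (Nat.card {a : ℕ // memA a ∧ (|discA a| : ℝ) ≤ X ∧
            omegaMod4 1 a = k₁ ∧ omegaMod4 3 a = k₂} : ℝ))
      =O[atTop] fun X : ℝ =>
        X ^ ((1 : ℝ) / 3) / ((Nat.factorial (k₁ + k₂ - 1) : ℝ) * Real.log X) *
          (Real.log (Real.log X)) ^ (k₁ + k₂ - 1) := by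
  obtain ⟨k, hk'⟩ : ∃ k, k₁ + k₂ = k + 1 := ⟨k₁ + k₂ - 1, by omega⟩
  rw [hk', Nat.add_sub_cancel]
  have hfac : (0 : ℝ) < k.factorial := by exact_mod_cast k.factorial_pos
  refine Asymptotics.IsBigO.of_bound (4 * k.factorial * (1 + 54 * Real.log 4 * 72 ^ k)) ?_
  have hsmall : ∀ᶠ X : ℝ in atTop, ‖Real.log X‖ ≤ 1 * ‖X ^ ((1 : ℝ) / 6)‖ :=
    (isLittleO_log_rpow_atTop (by norm_num)).bound one_pos
  filter_upwards [eventually_ge_atTop 1, Real.tendsto_log_atTop.eventually_ge_atTop 3, hsmall]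
    with X hX hL hLX
  rw [one_mul, Real.norm_of_nonneg (by linarith), Real.norm_of_nonneg (by positivity)] at hLX
  have hLL : 0 ≤ Real.log (Real.log X) := Real.log_nonneg (by linarith)
  rw [Real.norm_of_nonneg (by positivity), Real.norm_of_nonneg (by positivity)]
  have h1 := card_memA_le k₁ k₂ (X := X) (by linarith)
  rw [hk'] at h1
  calc _ ≤ (4 : ℝ) * (fourthPowerFree (k + 1) ⌊X ^ ((1 : ℝ) / 3)⌋₊).card := by exact_mod_cast h1
    _ ≤ 4 * ((1 + 54 * Real.log 4 * 72 ^ k) *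
        (X ^ ((1 : ℝ) / 3) / Real.log X * Real.log (Real.log X) ^ k)) := by
      gcongr
      exact card_fourthPowerFree_le k hX hL hLX
    _ = _ := by
      field_simp
end
end

section
/- For every integer t ≥ 0, the ratio #{a ∈ 𝒜 : |𝒟(a)| ≤ X and g(a) = 2^t} / #{a ∈ 𝒜 : |𝒟(a)| ≤ X} tends to 0 as X → ∞, where g(a) := 2^{ω₃(a)−1}·4^{ω₁(a)} if a ≡ 1 (mod 4); g(a) := 2^{ω₃(a)}·4^{ω₁(a)} if a is even; and g(a) := 2^{ω₃(a)+min(N,3)−2}·4^{ω₁(a)} if a ≡ 3 (mod 4), where N is defined by 2^N ∥ (a+1). -/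
/- STATEMENT 18: For every t ≥ 0, the proportion of a ∈ 𝒜 with |𝒟(a)| ≤ X whose genus
number g(a) equals 2^t tends to 0 as X → ∞. -/

open scoped Classical
open Filter
noncomputable section

/-- The genus number `g(a)` of the pure quartic field ℚ(⁴√a) (Ishida's theorem). -/
noncomputable def genusA (a : ℕ) : ℝ :=
  if a % 4 = 1 then
    (2 : ℝ) ^ ((omegaMod4 3 a : ℤ) - 1) * (4 : ℝ) ^ (omegaMod4 1 a)
  else if a % 2 = 0 then
    (2 : ℝ) ^ (omegaMod4 3 a) * (4 : ℝ) ^ (omegaMod4 1 a)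
  else
    (2 : ℝ) ^ ((omegaMod4 3 a : ℤ) + min ((a + 1).factorization 2) 3 - 2) *
      (4 : ℝ) ^ (omegaMod4 1 a)

open Finset in
/-- The second moment of the number of divisors of `n` in `P` about the mean `∑ 1 / p`. -/
lemma sum_sq_card_dvd_sub_le (P : Finset ℕ) (hP : ∀ p ∈ P, p.Prime) (N : ℕ) :
    ∑ n ∈ Ioc 0 N, ((#{p ∈ P | p ∣ n} : ℝ) - ∑ p ∈ P, (1 / p : ℝ)) ^ 2 ≤
      N * (∑ p ∈ P, (1 / p : ℝ)) + 2 * (∑ p ∈ P, (1 / p : ℝ)) * #P := by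
  set L := ∑ p ∈ P, (1 / p : ℝ) with hL
  have hL0 : 0 ≤ L := sum_nonneg fun p _ => by positivity
  have hcard (d : ℕ) : (∑ n ∈ Ioc 0 N, if d ∣ n then (1 : ℝ) else 0) = (N / d : ℕ) := by
    rw [← Nat.Ioc_filter_dvd_card_eq_div, card_filter]
    push_cast
    rfl
  have hind (n : ℕ) : (#{p ∈ P | p ∣ n} : ℝ) = ∑ p ∈ P, if p ∣ n then (1 : ℝ) else 0 := by
    rw [card_filter]
    push_cast
    rfl
  have hfirst : N * L - #P ≤ ∑ n ∈ Ioc 0 N, (#{p ∈ P | p ∣ n} : ℝ) := by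
    simp_rw [hind]
    rw [sum_comm]
    simp_rw [hcard]
    rw [hL, mul_sum, card_eq_sum_ones]
    push_cast
    rw [← sum_sub_distrib]
    refine sum_le_sum fun p _ => ?_
    have h := (Nat.lt_floor_add_one ((N : ℝ) / p)).le
    rw [Nat.floor_div_eq_div] at h
    rw [mul_one_div]
    linarith
  have hsecond : ∑ n ∈ Ioc 0 N, (#{p ∈ P | p ∣ n} : ℝ) ^ 2 ≤ N * L ^ 2 + N * L := by
    have hexp (n : ℕ) : (#{p ∈ P | p ∣ n} : ℝ) ^ 2 =
        ∑ p ∈ P, ∑ q ∈ P, if p.lcm q ∣ n then (1 : ℝ) else 0 := by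
      rw [hind, sq, sum_mul_sum]
      refine sum_congr rfl fun p _ => sum_congr rfl fun q _ => ?_
      by_cases h1 : p ∣ n <;> by_cases h2 : q ∣ n <;> simp [h1, h2, Nat.lcm_dvd_iff]
    simp_rw [hexp]
    rw [sum_comm]
    have hN : N * L ^ 2 + N * L =
        ∑ p ∈ P, ((∑ q ∈ P, (N * (1 / p) * (1 / q) : ℝ)) + N * (1 / p)) := by
      rw [sum_add_distrib, ← mul_sum, sq, hL, sum_mul_sum, mul_sum]
      simp_rw [mul_sum, mul_assoc]
    rw [hN]
    refine sum_le_sum fun p hp => ?_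
    rw [sum_comm]
    simp_rw [hcard]
    have hdiag : (∑ q ∈ P, (N * (1 / p) * (1 / q) : ℝ)) + N * (1 / p) =
        ∑ q ∈ P, ((N * (1 / p) * (1 / q) : ℝ) + if p = q then (N * (1 / p) : ℝ) else 0) := by
      rw [sum_add_distrib, sum_ite_eq, if_pos hp]
    rw [hdiag]
    refine sum_le_sum fun q hq => ?_
    refine Nat.cast_div_le.trans ?_
    by_cases hpq : p = q
    · subst hpq
      simp only [Nat.lcm_self, if_true]
      have : (0 : ℝ) ≤ N * (1 / p) * (1 / p) := by positivity
      rw [← mul_one_div]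
      linarith
    · rw [((Nat.coprime_primes (hP p hp) (hP q hq)).2 hpq).lcm_eq_mul, if_neg hpq]
      apply le_of_eq
      push_cast
      simp [div_eq_mul_inv, mul_comm, mul_assoc]
  have hsq : ∑ n ∈ Ioc 0 N, ((#{p ∈ P | p ∣ n} : ℝ) - L) ^ 2 =
      ∑ n ∈ Ioc 0 N, (#{p ∈ P | p ∣ n} : ℝ) ^ 2 - 2 * L * ∑ n ∈ Ioc 0 N, (#{p ∈ P | p ∣ n} : ℝ)
        + N * L ^ 2 := by
    simp_rw [sub_sq]
    rw [sum_add_distrib, sum_sub_distrib, mul_sum]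
    simp only [sum_const, Nat.card_Ioc, nsmul_eq_mul, Nat.sub_zero]
    congr 2
    exact sum_congr rfl fun n _ => by ring
  rw [hsq]
  nlinarith [mul_le_mul_of_nonneg_left hfirst hL0]

/-- There are finite sets of primes whose sum of reciprocals is arbitrarily large. -/
lemma exists_primes_sum_one_div_ge (B : ℝ) :
    ∃ P : Finset ℕ, (∀ p ∈ P, p.Prime) ∧ B ≤ ∑ p ∈ P, (1 / p : ℝ) := by
  by_contra! h
  refine Nat.Primes.not_summable_one_div (summable_of_sum_le (c := B) (fun p => by positivity) ?_)
  intro u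
  have := h (u.map ⟨fun p : Nat.Primes => (p : ℕ), Subtype.val_injective⟩) (by
    intro p hp
    obtain ⟨q, -, rfl⟩ := Finset.mem_map.1 hp
    exact q.2)
  rw [Finset.sum_map] at this
  exact this.le

open Finset in
/-- The integers with at most `k` prime factors have density zero. -/
lemma eventually_card_primeFactors_le (k : ℕ) {ε : ℝ} (hε : 0 < ε) :
    ∀ᶠ N : ℕ in atTop, (#{n ∈ Ioc 0 N | #n.primeFactors ≤ k} : ℝ) ≤ ε * N := by
  obtain ⟨P, hP, hB⟩ := exists_primes_sum_one_div_ge (2 * k + 1 + 8 / ε)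
  have hmom := sum_sq_card_dvd_sub_le P hP
  set L := ∑ p ∈ P, (1 / p : ℝ)
  have hε8 : 0 < 8 / ε := by positivity
  have hk : (0 : ℝ) ≤ k := k.cast_nonneg
  have hL : 0 < L := by linarith
  filter_upwards [eventually_ge_atTop (2 * #P)] with N hN
  have hN' : 2 * (#P : ℝ) ≤ N := by exact_mod_cast hN
  have hlow : (#{n ∈ Ioc 0 N | #n.primeFactors ≤ k} : ℝ) * (L / 2) ^ 2 ≤
      ∑ n ∈ Ioc 0 N, ((#{p ∈ P | p ∣ n} : ℝ) - L) ^ 2 := by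
    rw [← nsmul_eq_mul, ← sum_const]
    refine (sum_le_sum fun n hn => ?_).trans
      (sum_le_sum_of_subset_of_nonneg (filter_subset _ _) fun n _ _ => sq_nonneg _)
    rw [mem_filter, mem_Ioc] at hn
    have hle : #{p ∈ P | p ∣ n} ≤ k := (card_le_card fun p hp => by
      rw [mem_filter] at hp
      exact Nat.mem_primeFactors.2 ⟨hP p hp.1, hp.2, hn.1.1.ne'⟩).trans hn.2
    have hle' : (#{p ∈ P | p ∣ n} : ℝ) ≤ k := by exact_mod_cast hle
    nlinarith
  have hup := hlow.trans (hmom N)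
  have hmain : (#{n ∈ Ioc 0 N | #n.primeFactors ≤ k} : ℝ) * L ≤ 8 * N := by
    refine le_of_mul_le_mul_right ?_ hL
    nlinarith
  have hεL : 8 ≤ ε * L := by
    have h8 : 8 / ε ≤ L := by linarith
    rwa [div_le_iff₀' hε] at h8
  refine le_of_mul_le_mul_right (hmain.trans ?_) hL
  nlinarith [(N.cast_nonneg : (0 : ℝ) ≤ N)]

open Finset in
/-- At least a quarter of the positive integers up to `N` are squarefree. -/
lemma div_four_le_card_squarefree (N : ℕ) :
    (N / 4 : ℝ) ≤ #{n ∈ Ioc 0 N | Squarefree n} := by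
  have hsum (m : ℕ) : ∑ d ∈ Ioc 1 (m + 2), (1 / (d : ℝ) ^ 2 : ℝ) ≤ 3 / 4 - 1 / (m + 2 : ℝ) := by
    induction m with
    | zero => norm_num [show Ioc 1 2 = {2} from rfl]
    | succ m ih =>
      rw [show m + 1 + 2 = (m + 2) + 1 from rfl, sum_Ioc_succ_top (by omega)]
      refine (add_le_add_left ih _).trans ?_
      push_cast
      have : 1 / ((m : ℝ) + 2 + 1) ^ 2 ≤ 1 / (m + 2) - 1 / (m + 1 + 2) := by
        rw [div_sub_div _ _ (by positivity) (by positivity),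
          div_le_div_iff₀ (by positivity) (by positivity)]
        nlinarith [(m.cast_nonneg : (0 : ℝ) ≤ m)]
      linarith
  have hsum' : ∑ d ∈ Ioc 1 N, (1 / (d : ℝ) ^ 2 : ℝ) ≤ 3 / 4 := by
    refine (sum_le_sum_of_subset_of_nonneg (Ioc_subset_Ioc_right (Nat.le_add_right N 2))
      fun d _ _ => by positivity).trans ((hsum N).trans ?_)
    have : (0 : ℝ) ≤ 1 / (N + 2) := by positivity
    linarith
  have hcover : {n ∈ Ioc 0 N | ¬ Squarefree n} ⊆
      (Ioc 1 N).biUnion fun d => {n ∈ Ioc 0 N | d ^ 2 ∣ n} := by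
    intro n hn
    rw [mem_filter, mem_Ioc, Nat.squarefree_iff_prime_squarefree] at hn
    obtain ⟨⟨hn0, hnN⟩, hsq⟩ := hn
    push Not at hsq
    obtain ⟨p, hp, hpn⟩ := hsq
    simp only [mem_biUnion, mem_filter, mem_Ioc]
    exact ⟨p, ⟨hp.one_lt, (Nat.le_of_dvd hn0 (dvd_of_mul_left_dvd hpn)).trans hnN⟩,
      ⟨hn0, hnN⟩, sq p ▸ hpn⟩
  have hbad : (#{n ∈ Ioc 0 N | ¬ Squarefree n} : ℝ) ≤ N * (3 / 4) := by
    calc (#{n ∈ Ioc 0 N | ¬ Squarefree n} : ℝ)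
        ≤ ∑ d ∈ Ioc 1 N, (#{n ∈ Ioc 0 N | d ^ 2 ∣ n} : ℝ) := by
          exact_mod_cast (card_le_card hcover).trans card_biUnion_le
      _ ≤ ∑ d ∈ Ioc 1 N, N * (1 / (d : ℝ) ^ 2) := by
          refine sum_le_sum fun d _ => ?_
          rw [Nat.Ioc_filter_dvd_card_eq_div, mul_one_div]
          exact_mod_cast Nat.cast_div_le
      _ ≤ N * (3 / 4) := by
          rw [← mul_sum]
          gcongr
  have htot := card_filter_add_card_filter_not (s := Ioc 0 N) (fun n => Squarefree n)
  rw [Nat.card_Ioc, Nat.sub_zero] at htot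
  have htot' : (#{n ∈ Ioc 0 N | Squarefree n} : ℝ) + #{n ∈ Ioc 0 N | ¬ Squarefree n} = N := by
    exact_mod_cast htot
  linarith

lemma memA_of_squarefree {a : ℕ} (ha : 2 ≤ a) (hs : Squarefree a) : memA a :=
  ⟨ha, fun p hp hpa => Or.inl <| le_antisymm (hs.natFactorization_le_one p)
    (hp.factorization_pos_of_dvd (by omega) hpa)⟩

lemma four_mul_cube_le_abs_discA (a : ℕ) : 4 * (a : ℤ) ^ 3 ≤ |discA a| := by
  have h : (0 : ℤ) ≤ (a : ℤ) ^ 3 := by positivity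
  unfold discA
  split_ifs <;> rw [abs_of_nonpos (by linarith)] <;> linarith

lemma abs_discA_le (a : ℕ) : |discA a| ≤ 256 * (a : ℤ) ^ 3 := by
  have h : (0 : ℤ) ≤ (a : ℤ) ^ 3 := by positivity
  unfold discA
  split_ifs <;> rw [abs_of_nonpos (by linarith)] <;> linarith

open Finset in
lemma card_primeFactors_le_omegaMod4 (a : ℕ) :
    #a.primeFactors ≤ omegaMod4 3 a + omegaMod4 1 a + 1 := by
  have hsub : a.primeFactors ⊆ (({p ∈ a.primeFactors | p % 4 = 3}) ∪
      {p ∈ a.primeFactors | p % 4 = 1}) ∪ {2} := by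
    intro p hp
    simp only [mem_union, mem_filter, mem_singleton, hp, true_and]
    rcases (Nat.prime_of_mem_primeFactors hp).eq_two_or_odd with h | h <;> omega
  refine (card_le_card hsub).trans ((card_union_le _ _).trans ?_)
  rw [card_singleton]
  exact Nat.add_le_add_right (card_union_le _ _) 1

/-- The genus number bounds the number of prime factors. -/
lemma card_primeFactors_le_of_genusA_eq {a t : ℕ} (h : genusA a = 2 ^ t) :
    a.primeFactors.card ≤ t + 3 := by
  have hcard := card_primeFactors_le_omegaMod4 a
  have h4 (n : ℕ) : (4 : ℝ) ^ n = 2 ^ (2 * n : ℤ) := by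
    rw [zpow_mul]
    norm_num
  have hinj : Function.Injective fun z : ℤ => (2 : ℝ) ^ z :=
    zpow_right_injective₀ (by norm_num) (by norm_num)
  unfold genusA at h
  rw [← zpow_natCast 2 t, h4] at h
  split_ifs at h
  · rw [← zpow_add₀ two_ne_zero] at h
    have := hinj h
    omega
  · rw [← zpow_natCast, ← zpow_add₀ two_ne_zero] at h
    have := hinj h
    omega
  · rw [← zpow_add₀ two_ne_zero] at h
    have := hinj h
    omega

/-- The elements of `𝒜` of discriminant at most `X` are at most `4 * M + 4` and include those
up to `M`, where `M` is the integral part of the cube root of `X / 256`. -/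
lemma exists_cube_root_bounds {X : ℝ} (hX : 0 ≤ X) (n : ℕ) (hn : (256 * (n : ℝ) ^ 3) ≤ X) :
    ∃ M : ℕ, n ≤ M ∧ (∀ a : ℕ, a ≤ M → (|discA a| : ℝ) ≤ X) ∧
      ∀ a : ℕ, (|discA a| : ℝ) ≤ X → a ≤ 4 * M + 4 := by
  obtain ⟨y, hy0, hy⟩ : ∃ y : ℝ, 0 ≤ y ∧ 256 * y ^ 3 = X :=
    ⟨(X / 256) ^ ((3 : ℕ) : ℝ)⁻¹, by positivity, by
      rw [Real.rpow_inv_natCast_pow (by positivity) (by norm_num)]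
      ring⟩
  refine ⟨⌊y⌋₊, Nat.le_floor ?_, fun a ha => ?_, fun a ha => ?_⟩
  · refine le_of_pow_le_pow_left₀ three_ne_zero hy0 ?_
    linarith
  · have hay : (a : ℝ) ≤ y := (Nat.le_floor_iff hy0).1 ha
    have hd : (|discA a| : ℝ) ≤ 256 * (a : ℝ) ^ 3 := by exact_mod_cast abs_discA_le a
    have : (a : ℝ) ^ 3 ≤ y ^ 3 := by gcongr
    linarith
  · have hd : 4 * (a : ℝ) ^ 3 ≤ (|discA a| : ℝ) := by exact_mod_cast four_mul_cube_le_abs_discA a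
    have h1 : (a : ℝ) ≤ 4 * y := by
      refine le_of_pow_le_pow_left₀ three_ne_zero (by positivity) ?_
      rw [mul_pow]
      linarith
    have h2 := Nat.lt_floor_add_one y
    have h3 : (a : ℝ) ≤ ((4 * ⌊y⌋₊ + 4 : ℕ) : ℝ) := by
      push_cast
      linarith
    exact_mod_cast h3

theorem stmt_18 (t : ℕ) :
    Tendsto
      (fun X : ℝ =>
        (Nat.card {a : ℕ // memA a ∧ (|discA a| : ℝ) ≤ X ∧ genusA a = 2 ^ t} : ℝ) /
          (Nat.card {a : ℕ // memA a ∧ (|discA a| : ℝ) ≤ X} : ℝ))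
      atTop (nhds 0) := by
  rw [Metric.tendsto_atTop]
  intro ε hε
  obtain ⟨n, hn⟩ := eventually_atTop.1
    (eventually_card_primeFactors_le (t + 3) (show 0 < ε / 128 by positivity))
  refine ⟨256 * ((n + 8 : ℕ) : ℝ) ^ 3, fun X hX => ?_⟩
  obtain ⟨M, hM, hlow, hup⟩ := exists_cube_root_bounds (le_trans (by positivity) hX) (n + 8) hX
  have hM8 : (8 : ℝ) ≤ M := by exact_mod_cast (show 8 ≤ M by omega)
  have hnum : (Nat.card {a : ℕ // memA a ∧ (|discA a| : ℝ) ≤ X ∧ genusA a = 2 ^ t} : ℝ) ≤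
      ε / 128 * (4 * M + 4 : ℕ) := by
    refine le_trans ?_ (hn (4 * M + 4) (by omega))
    rw [Nat.cast_le, ← Set.ncard_coe_finset]
    refine Set.ncard_le_ncard (fun a ha => ?_) (Finset.finite_toSet _)
    rw [Finset.mem_coe, Finset.mem_filter, Finset.mem_Ioc]
    exact ⟨⟨by have := ha.1.1; omega, hup a ha.2.1⟩, card_primeFactors_le_of_genusA_eq ha.2.2⟩
  have hden : (M / 4 - 1 : ℝ) ≤ Nat.card {a : ℕ // memA a ∧ (|discA a| : ℝ) ≤ X} := by
    have hsub : (((Finset.Ioc 0 M).filter Squarefree).erase 1).card ≤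
        Nat.card {a : ℕ // memA a ∧ (|discA a| : ℝ) ≤ X} := by
      rw [← Set.ncard_coe_finset]
      refine Set.ncard_le_ncard (fun a ha => ?_)
        ((Set.finite_Iic (4 * M + 4)).subset fun a ha => hup a ha.2)
      rw [Finset.mem_coe, Finset.mem_erase, Finset.mem_filter, Finset.mem_Ioc] at ha
      exact ⟨memA_of_squarefree (by omega) ha.2.2, hlow a ha.2.1.2⟩
    have hsub' := (Nat.sub_le_iff_le_add.1 Finset.pred_card_le_card_erase).trans
      (Nat.add_le_add_right hsub 1)
    have := (div_four_le_card_squarefree M).trans (Nat.cast_le.2 hsub')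
    push_cast at this
    linarith
  rw [Real.dist_eq, sub_zero, abs_of_nonneg (by positivity), div_lt_iff₀ (by linarith)]
  push_cast at hnum
  nlinarith
end
end
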